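/- Let 𝒢 = (G_1,…,G_k) be a connected sunflower graph with shared graph S and simultaneous enumeration ρ = (σ_1,…,σ_k). Then a tuple ρ' = (σ'_1,…,σ'_k) of straight enumerations of G_1,…,G_k is a simultaneous enumeration of 𝒢 if and only if ρ' can be obtained from ρ or from its full reversal ρ^r through reversals of independent components and reversals of reversible parts. -/

import Mathlib

/-!
Common definitions: graphs on a vertex subset, (proper/unit) interval
representations, blocks, straight enumerations, sunflower graphs,
simultaneous enumerations, components, chains/bars, etc.
-/

universe u

/-- A finite simple graph on a subset `verts` of an ambient vertex type `V`. -/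
structure GraphOn (V : Type u) where
  verts : Set V
  Adj : V → V → Prop
  symm : ∀ {u v}, Adj u v → Adj v u
  loopless : ∀ v, ¬ Adj v v
  mem_of_adj : ∀ {u v}, Adj u v → u ∈ verts ∧ v ∈ verts

namespace GraphOn

variable {V : Type u}

/-- The closed real interval assigned to vertex `v` by the endpoint map `I`. -/
def ivl (I : V → ℝ × ℝ) (v : V) : Set ℝ := Set.Icc (I v).1 (I v).2

/-- `I` is an interval representation of `G`: each vertex gets a (nonempty) closed
interval and intervals of distinct vertices intersect iff the vertices are adjacent. -/
def IsRep (G : GraphOn V) (I : V → ℝ × ℝ) : Prop :=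
  (∀ v ∈ G.verts, (I v).1 ≤ (I v).2) ∧
    ∀ u ∈ G.verts, ∀ v ∈ G.verts, u ≠ v → ((ivl I u ∩ ivl I v).Nonempty ↔ G.Adj u v)

/-- A proper interval representation: no interval properly contains another. -/
def IsProperRep (G : GraphOn V) (I : V → ℝ × ℝ) : Prop :=
  G.IsRep I ∧ ∀ u ∈ G.verts, ∀ v ∈ G.verts, u ≠ v → ¬ ivl I v ⊂ ivl I u

/-- A unit interval representation: all intervals have length one. -/
def IsUnitRep (G : GraphOn V) (I : V → ℝ × ℝ) : Prop :=
  G.IsRep I ∧ ∀ v ∈ G.verts, (I v).2 = (I v).1 + 1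

/-- Two vertices are in the same block iff they have equal closed neighborhoods. -/
def SameBlock (G : GraphOn V) (u v : V) : Prop :=
  u ∈ G.verts ∧ v ∈ G.verts ∧ ∀ w, (G.Adj u w ∨ u = w) ↔ (G.Adj v w ∨ v = w)

/-- Block-level closed adjacency: adjacent or in the same block. -/
def CAdj (G : GraphOn V) (u v : V) : Prop := G.Adj u v ∨ G.SameBlock u v

/-- `u` and `v` lie in the same connected component of `G` (and in `G`). -/
def Reach (G : GraphOn V) (u v : V) : Prop :=
  u ∈ G.verts ∧ v ∈ G.verts ∧ Relation.ReflTransGen G.Adj u v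

/-- The subgraph of `G` induced on the vertices of `G` lying in `C`. -/
def restrict (G : GraphOn V) (C : Set V) : GraphOn V where
  verts := G.verts ∩ C
  Adj u v := G.Adj u v ∧ u ∈ C ∧ v ∈ C
  symm h := ⟨G.symm h.1, h.2.2, h.2.1⟩
  loopless v h := G.loopless v h.1
  mem_of_adj h := ⟨⟨(G.mem_of_adj h.1).1, h.2.1⟩, (G.mem_of_adj h.1).2, h.2.2⟩

end GraphOn

open GraphOn

variable {V : Type u}

/-- The union graph `G_1 ∪ … ∪ G_k`. -/
def unionGraph {k : ℕ} (G : Fin k → GraphOn V) : GraphOn V where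
  verts := ⋃ i, (G i).verts
  Adj u v := ∃ i, (G i).Adj u v
  symm h := h.elim fun i hi => ⟨i, (G i).symm hi⟩
  loopless v h := h.elim fun i hi => (G i).loopless v hi
  mem_of_adj h := h.elim fun i hi =>
    ⟨Set.mem_iUnion.2 ⟨i, ((G i).mem_of_adj hi).1⟩,
     Set.mem_iUnion.2 ⟨i, ((G i).mem_of_adj hi).2⟩⟩

/-- A straight enumeration of `G`, encoded at the vertex level: `le u v` means the
block of `u` comes at or before the block of `v`.  It is a total preorder on the
vertices whose equivalence classes are exactly the blocks, and such that every block
together with its adjacent blocks is consecutive. -/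
structure StraightEnum {V : Type u} (G : GraphOn V) where
  le : V → V → Prop
  refl : ∀ v ∈ G.verts, le v v
  trans : ∀ u ∈ G.verts, ∀ v ∈ G.verts, ∀ w ∈ G.verts, le u v → le v w → le u w
  total : ∀ u ∈ G.verts, ∀ v ∈ G.verts, le u v ∨ le v u
  eq_block : ∀ u ∈ G.verts, ∀ v ∈ G.verts, (le u v ∧ le v u ↔ G.SameBlock u v)
  straight : ∀ u ∈ G.verts, ∀ v ∈ G.verts, ∀ w ∈ G.verts,
    le u v → le v w → G.CAdj u w → G.CAdj u v ∧ G.CAdj v w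

/-- `B(u,G) <_σ B(v,G)`: the block of `u` comes strictly before the block of `v`. -/
def StraightEnum.lt {V : Type u} {G : GraphOn V} (σ : StraightEnum G) (u v : V) : Prop :=
  σ.le u v ∧ ¬ σ.le v u

/-- `le` is a linear order on the set `s`. -/
def IsLinOrdOn (s : Set V) (le : V → V → Prop) : Prop :=
  (∀ v ∈ s, le v v) ∧ (∀ u ∈ s, ∀ v ∈ s, ∀ w ∈ s, le u v → le v w → le u w) ∧
    (∀ u ∈ s, ∀ v ∈ s, le u v → le v u → u = v) ∧ (∀ u ∈ s, ∀ v ∈ s, le u v ∨ le v u)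

/-- `le` is a partial order on the set `s`. -/
def IsPartialOrderOn (s : Set V) (le : V → V → Prop) : Prop :=
  (∀ v ∈ s, le v v) ∧ (∀ u ∈ s, ∀ v ∈ s, ∀ w ∈ s, le u v → le v w → le u w) ∧
    (∀ u ∈ s, ∀ v ∈ s, le u v → le v u → u = v)

/-- `S` is an induced subgraph of `G`. -/
def IsInduced (S G : GraphOn V) : Prop :=
  S.verts ⊆ G.verts ∧ ∀ u ∈ S.verts, ∀ v ∈ S.verts, (S.Adj u v ↔ G.Adj u v)

/-- `(G_1,…,G_k)` is a sunflower graph with shared graph `S`: any two distinct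
graphs share exactly `S` (vertices and edges), and `S` is induced in each `G_i`. -/
def IsSunflower {k : ℕ} (G : Fin k → GraphOn V) (S : GraphOn V) : Prop :=
  (∀ i, IsInduced S (G i)) ∧
    ∀ i j, i ≠ j → (G i).verts ∩ (G j).verts = S.verts ∧
      ∀ u v, (G i).Adj u v → (G j).Adj u v → S.Adj u v

/-- `𝒢` admits a simultaneous interval representation. -/
def HasSimRep {k : ℕ} (G : Fin k → GraphOn V) : Prop :=
  ∃ I : V → ℝ × ℝ, ∀ i, (G i).IsRep I

/-- `𝒢` admits a simultaneous proper interval representation. -/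
def HasSimProperRep {k : ℕ} (G : Fin k → GraphOn V) : Prop :=
  ∃ I : V → ℝ × ℝ, ∀ i, (G i).IsProperRep I

/-- `𝒢` admits a simultaneous unit interval representation. -/
def HasSimUnitRep {k : ℕ} (G : Fin k → GraphOn V) : Prop :=
  ∃ I : V → ℝ × ℝ, ∀ i, (G i).IsUnitRep I

/-- The representation `I` of `G` corresponds to (realizes) the straight enumeration `σ`:
ordering the intervals by left endpoints and grouping blocks yields `σ`. -/
def Realizes (G : GraphOn V) (I : V → ℝ × ℝ) (σ : StraightEnum G) : Prop :=
  ∀ u ∈ G.verts, ∀ v ∈ G.verts, σ.lt u v → (I u).1 < (I v).1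

/-- Simultaneous enumeration: blocks containing shared vertices are never ordered
oppositely in two of the straight enumerations. -/
def IsSimEnum {k : ℕ} (G : Fin k → GraphOn V) (S : GraphOn V)
    (σ : ∀ i, StraightEnum (G i)) : Prop :=
  ∀ i j, ∀ u ∈ S.verts, ∀ v ∈ S.verts, (σ i).lt u v → (σ j).le u v

/-- A straight enumeration `σ` of `G` is compatible with a linear order `ζ` of the
shared vertex set `VS`: `u ≤_ζ v` implies `B(u,G) ≤_σ B(v,G)`. -/
def Compatible (G : GraphOn V) (σ : StraightEnum G) (VS : Set V) (ζ : V → V → Prop) : Prop :=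
  ∀ u ∈ VS, ∀ v ∈ VS, ζ u v → σ.le u v

/-- The component of `c` in `G` is loose: all its shared vertices lie in one block of `S`. -/
def LooseAt (G S : GraphOn V) (c : V) : Prop :=
  c ∈ G.verts ∧ ∀ u v, G.Reach c u → G.Reach c v → u ∈ S.verts → v ∈ S.verts → S.SameBlock u v

/-- The component of `c` in `G` is oriented at the block of `b` in `S`: it aligns two
vertices of that block (they lie in different blocks of the component). -/
def OrientedAt (G S : GraphOn V) (c b : V) : Prop :=
  c ∈ G.verts ∧ b ∈ S.verts ∧ ∃ u v, G.Reach c u ∧ G.Reach c v ∧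
    S.SameBlock b u ∧ S.SameBlock b v ∧ ¬ G.SameBlock u v

/-- The component of `c` in `G` is independent: it aligns no two shared vertices. -/
def IndependentAt (G S : GraphOn V) (c : V) : Prop :=
  c ∈ G.verts ∧ ∀ u v, G.Reach c u → G.Reach c v → u ∈ S.verts → v ∈ S.verts → G.SameBlock u v

/-- `le'` is obtained from `le` by reversing exactly the components marked by `flip`
(componentwise-constant), keeping the order of the components themselves. -/
def ObtainedByFlip (G : GraphOn V) (flip : V → Prop) (le le' : V → V → Prop) : Prop :=
  (∀ u v, G.Reach u v → (flip u ↔ flip v)) ∧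
    ∀ u ∈ G.verts, ∀ v ∈ G.verts,
      (G.Reach u v → ((flip u → (le' u v ↔ le v u)) ∧ (¬ flip u → (le' u v ↔ le u v)))) ∧
      (¬ G.Reach u v → (le' u v ↔ le u v))

/-- `le'` is obtained from `le` through reversal of loose components. -/
def ObtainedByLooseReversals (G S : GraphOn V) (le le' : V → V → Prop) : Prop :=
  ∃ flip : V → Prop, (∀ c ∈ G.verts, flip c → LooseAt G S c) ∧
    ObtainedByFlip G flip le le'

/-- A family of flips (one per graph) corresponding to reversals of independent
components and of reversible parts: only loose components are flipped, and all
components oriented at a common block of `S` are flipped consistently and, if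
flipped, are all loose. -/
def ValidFlips {k : ℕ} (G : Fin k → GraphOn V) (S : GraphOn V)
    (flip : Fin k → V → Prop) : Prop :=
  (∀ i, ∀ c ∈ (G i).verts, flip i c → LooseAt (G i) S c) ∧
    ∀ b ∈ S.verts, ∀ i j c c', OrientedAt (G i) S c b → OrientedAt (G j) S c' b →
      (flip i c ↔ flip j c') ∧ (flip i c → LooseAt (G j) S c')

/-- `le` is a fine enumeration of the graph with vertex set `verts` and adjacency
`Adj`: a linear order on `verts` in which every closed neighborhood is consecutive. -/
def FineEnumOn (verts : Set V) (Adj : V → V → Prop) (le : V → V → Prop) : Prop :=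
  IsLinOrdOn verts le ∧
    ∀ u ∈ verts, ∀ a ∈ verts, ∀ b ∈ verts, ∀ c ∈ verts,
      le a b → le b c → (Adj u a ∨ u = a) → (Adj u c ∨ u = c) → (Adj u b ∨ u = b)

/-- A `(u,v)`-chain of size `l` in `(G,σ)`: a `σ`-increasing sequence from `u` to `v`
forming a path in `G`. -/
def IsChainSeq (G : GraphOn V) (σ : StraightEnum G) (u v : V) (l : ℕ) : Prop :=
  ∃ c : ℕ → V, c 0 = u ∧ c (l - 1) = v ∧ (∀ t < l, c t ∈ G.verts) ∧
    (∀ s t, s < t → t < l → σ.lt (c s) (c t)) ∧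
    (∀ t, t + 1 < l → G.Adj (c t) (c (t + 1)))

/-- A `(u,v)`-bar of size `l` in `(G,σ)`: a `σ`-increasing sequence from `u` to `v`
forming an independent set in `G`. -/
def IsBarSeq (G : GraphOn V) (σ : StraightEnum G) (u v : V) (l : ℕ) : Prop :=
  ∃ b : ℕ → V, b 0 = u ∧ b (l - 1) = v ∧ (∀ t < l, b t ∈ G.verts) ∧
    (∀ s t, s < t → t < l → σ.lt (b s) (b t)) ∧
    (∀ s t, s < l → t < l → s ≠ t → ¬ G.Adj (b s) (b t))

/-- `𝒢` has a (chain-bar-)conflict for the simultaneous enumeration `σ`. -/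
def HasConflict {k : ℕ} (G : Fin k → GraphOn V) (S : GraphOn V)
    (σ : ∀ i, StraightEnum (G i)) : Prop :=
  ∃ u ∈ S.verts, ∃ v ∈ S.verts, u ≠ v ∧ ∃ i j l, 2 ≤ l ∧
    IsChainSeq (G i) (σ i) u v l ∧ ∃ m, l ≤ m ∧ IsBarSeq (G j) (σ j) u v m

/-- The union of the block orders of the single enumerations. -/
def alphaStar {k : ℕ} (G : Fin k → GraphOn V) (σ : ∀ i, StraightEnum (G i))
    (u v : V) : Prop :=
  ∃ i, u ∈ (G i).verts ∧ v ∈ (G i).verts ∧ (σ i).le u v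

/-- The partial order `α` on `V(𝒢)` induced by the simultaneous enumeration:
the transitive closure of the union of the single block orders. -/
def alphaOrd {k : ℕ} (G : Fin k → GraphOn V) (σ : ∀ i, StraightEnum (G i)) :
    V → V → Prop :=
  Relation.TransGen (alphaStar G σ)

/-- The `α`-ordered pairs that are edges of some `G_i`. -/
def ERel {k : ℕ} (G : Fin k → GraphOn V) (σ : ∀ i, StraightEnum (G i))
    (u v : V) : Prop :=
  alphaOrd G σ u v ∧ ∃ i, (G i).Adj u v

/-- The `α`-ordered pairs that are non-edges of some `G_i` (both endpoints in `G_i`). -/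
def FRel {k : ℕ} (G : Fin k → GraphOn V) (σ : ∀ i, StraightEnum (G i))
    (u v : V) : Prop :=
  alphaOrd G σ u v ∧ u ≠ v ∧ ∃ i, u ∈ (G i).verts ∧ v ∈ (G i).verts ∧ ¬ (G i).Adj u v

/-- A partial order `τ` is left-closed: `(v,w) ∈ E`, `(u,x) ∈ F` and `x ≤_τ w`
imply `u <_τ v`. -/
def LeftClosed {k : ℕ} (G : Fin k → GraphOn V) (σ : ∀ i, StraightEnum (G i))
    (τ : V → V → Prop) : Prop :=
  ∀ v w u x, ERel G σ v w → FRel G σ u x → τ x w → τ u v ∧ u ≠ v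

/-- A relaxed `(u,v)`-chain of size `l`: an `α`-increasing sequence from `u` to `v`
forming a path in the union graph `G* = G_1 ∪ … ∪ G_k`. -/
def IsRelaxedChainSeq {k : ℕ} (G : Fin k → GraphOn V) (σ : ∀ i, StraightEnum (G i))
    (u v : V) (l : ℕ) : Prop :=
  ∃ c : ℕ → V, c 0 = u ∧ c (l - 1) = v ∧ (∀ t < l, c t ∈ ⋃ i, (G i).verts) ∧
    (∀ s t, s < t → t < l → alphaOrd G σ (c s) (c t) ∧ c s ≠ c t) ∧
    (∀ t, t + 1 < l → ∃ i, (G i).Adj (c t) (c (t + 1)))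

/-- `𝒢` has a relaxed conflict for the simultaneous enumeration `σ`. -/
def HasRelaxedConflict {k : ℕ} (G : Fin k → GraphOn V) (S : GraphOn V)
    (σ : ∀ i, StraightEnum (G i)) : Prop :=
  ∃ u ∈ S.verts, ∃ v ∈ S.verts, u ≠ v ∧ ∃ j l, 2 ≤ l ∧
    IsRelaxedChainSeq G σ u v l ∧ ∃ m, l ≤ m ∧ IsBarSeq (G j) (σ j) u v m

/-! ### Total preorders that are straight with respect to a closed adjacency relation -/

section Abstract

variable {X : Type*} {le le' A : X → X → Prop}

/-- If every `A`-related pair is ordered alike by `le` and `le'`, two orders that are straight with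
respect to a connected relation `A` coincide. -/
theorem le_iff_of_agree_on_adj
    (total : ∀ u v, le u v ∨ le v u)
    (total' : ∀ u v, le' u v ∨ le' v u) (trans' : ∀ u v w, le' u v → le' v w → le' u w)
    (heq : ∀ u v, (le u v ∧ le v u) ↔ (le' u v ∧ le' v u))
    (symm : ∀ u v, A u v → A v u)
    (st : ∀ u v w, le u v → le v w → A u w → A u v ∧ A v w)
    (st' : ∀ u v w, le' u v → le' v w → A u w → A u v ∧ A v w)
    (conn : ∀ u v, Relation.ReflTransGen A u v)
    (agree : ∀ u v, A u v → le u v → le' u v) :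
    ∀ u v, le' u v ↔ le u v := by
  have key : ∀ u v, (le u v → le' u v) ∧ (le v u → le' v u) := by
    intro u v
    induction conn u v with
    | refl => exact ⟨fun h => ((heq u u).1 ⟨h, h⟩).1, fun h => ((heq u u).1 ⟨h, h⟩).1⟩
    | @tail v w _ hvw ih =>
      constructor
      · intro huw
        rcases total u v with huv | hvu
        · rcases total v w with h | h
          · exact trans' _ _ _ (ih.1 huv) (agree _ _ hvw h)
          · by_contra hn
            have h1 : le' w u := (total' u w).resolve_left hn
            have h2 := st' w u v h1 (ih.1 huv) (symm _ _ hvw)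
            exact hn (agree _ _ (symm _ _ h2.1) huw)
        · exact agree _ _ (st v u w hvu huw hvw).2 huw
      · intro hwu
        rcases total v u with hvu | huv
        · rcases total w v with h | h
          · exact trans' _ _ _ (agree _ _ (symm _ _ hvw) h) (ih.2 hvu)
          · by_contra hn
            have h1 : le' u w := (total' w u).resolve_left hn
            have h2 := st' v u w (ih.2 hvu) h1 hvw
            exact hn (agree _ _ (symm _ _ h2.2) hwu)
        · exact agree _ _ (st w u v hwu huv (symm _ _ hvw)).1 hwu
  intro u v
  refine ⟨fun h => ?_, (key u v).1⟩
  rcases total u v with h1 | h1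
  · exact h1
  · exact ((heq u v).2 ⟨h, (key u v).2 h1⟩).1

/-- Two orders that are straight with respect to a connected relation `A` are equal or reverse to
each other, provided that `le'` preserves betweenness on increasing triples with related ends. -/
theorem eq_or_reverse_of_between
    (total : ∀ u v, le u v ∨ le v u) (trans : ∀ u v w, le u v → le v w → le u w)
    (total' : ∀ u v, le' u v ∨ le' v u) (trans' : ∀ u v w, le' u v → le' v w → le' u w)
    (heq : ∀ u v, (le u v ∧ le v u) ↔ (le' u v ∧ le' v u))
    (symm : ∀ u v, A u v → A v u)
    (st : ∀ u v w, le u v → le v w → A u w → A u v ∧ A v w)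
    (st' : ∀ u v w, le' u v → le' v w → A u w → A u v ∧ A v w)
    (conn : ∀ u v, Relation.ReflTransGen A u v)
    (between : ∀ a b c, ¬ le b a → ¬ le c b → A a c → (le' a b ∧ le' b c) ∨ (le' c b ∧ le' b a)) :
    (∀ u v, le' u v ↔ le u v) ∨ (∀ u v, le' u v ↔ le v u) := by
  let Pos : X → Prop := fun v => ∀ w, A v w → (le v w → le' v w) ∧ (le w v → le' w v)
  let Neg : X → Prop := fun v => ∀ w, A v w → (le v w → le' w v) ∧ (le w v → le' v w)
  -- a strict triple `a < v < b` with `a`, `v` and `v`, `b` related is kept or reversed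
  have mid : ∀ a v b, ¬ le v a → ¬ le b v → A a v → A v b →
      (le' a v ∧ le' v b) ∨ (le' b v ∧ le' v a) := by
    intro a v b h1 h2 h3 h4
    by_cases h5 : A a b
    · exact between a v b h1 h2 h5
    · rcases total' a v with p | p <;> rcases total' v b with q | q
      · exact Or.inl ⟨p, q⟩
      · exfalso
        rcases total' a b with r | r
        · exact h5 (st' a b v r q h3).1
        · exact h5 (symm _ _ (st' b a v r p (symm _ _ h4)).1)
      · exfalso
        rcases total' a b with r | r
        · exact h5 (st' v a b p r h4).2
        · exact h5 (symm _ _ (st' v b a q r (symm _ _ h3)).2)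
      · exact Or.inr ⟨q, p⟩
  have dich : ∀ v, Pos v ∨ Neg v := by
    intro v
    by_contra! hcon
    obtain ⟨hp, hn⟩ := hcon
    simp only [Pos, Neg, not_forall] at hp hn
    obtain ⟨a, hva, ha⟩ := hp
    obtain ⟨b, hvb, hb⟩ := hn
    have hab := total a b
    have hav := total' a v
    have hbv := total' b v
    have e1 := heq v a
    have e2 := heq v b
    have e3 := heq a b
    have m1 := mid a v b
    have m2 := mid b v a
    have b1 := between v a b
    have b2 := between v b a
    have b3 := between a b v
    have b4 := between b a v
    have s1 := symm v a hva
    have s2 := symm v b hvb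
    have := trans' v a b
    have := trans' v b a
    have := trans' a b v
    have := trans' b a v
    have := total v a
    have := total v b
    grind
  have step : ∀ v w, A v w → Pos v → Pos w := by
    intro v w hvw hv
    rcases dich w with h | h
    · exact h
    · by_cases heqv : le v w ∧ le w v
      · intro x hwx
        have e := (heq v w).1 heqv
        constructor
        · intro hx
          have := (st w v x heqv.2 (trans _ _ _ heqv.1 hx) hwx).2
          exact trans' _ _ _ e.2 ((hv x this).1 (trans _ _ _ heqv.1 hx))
        · intro hx
          have := (st x v w (trans _ _ _ hx heqv.2) heqv.1 (symm _ _ hwx)).1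
          exact trans' _ _ _ ((hv x (symm _ _ this)).2 (trans _ _ _ hx heqv.2)) e.1
      · exfalso
        have h1 := hv w hvw
        have h2 := h v (symm _ _ hvw)
        have := heq v w
        have := total v w
        grind
  have glob : ∀ u v, Pos u → Pos v := by
    intro u v hu
    induction conn u v with
    | refl => exact hu
    | tail _ hvw ih => exact step _ _ hvw ih
  by_cases hex : ∃ u, Pos u
  · obtain ⟨u, hu⟩ := hex
    left
    exact le_iff_of_agree_on_adj total total' trans' heq symm st st' conn
      fun a b hab h => ((glob u a hu) b hab).1 h
  · right
    have hneg : ∀ u, Neg u := fun u => (dich u).resolve_left fun h => hex ⟨u, h⟩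
    intro u v
    exact le_iff_of_agree_on_adj (le' := fun a b => le' b a) total (fun a b => total' b a)
      (fun a b c h1 h2 => trans' _ _ _ h2 h1) (fun a b => (heq a b).trans and_comm) symm st
      (fun a b c h1 h2 h3 => (st' c b a h2 h1 (symm _ _ h3)).symm.imp (symm _ _) (symm _ _)) conn
      (fun a b hab h => ((hneg a) b hab).1 h) v u

/-- If the classes of two straight orders are the classes of equal closed neighborhoods, an
increasing triple with related ends stays monotone in the other order. -/
theorem between_of_adj
    (total : ∀ u v, le u v ∨ le v u)
    (total' : ∀ u v, le' u v ∨ le' v u) (trans' : ∀ u v w, le' u v → le' v w → le' u w)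
    (symm : ∀ u v, A u v → A v u)
    (st : ∀ u v w, le u v → le v w → A u w → A u v ∧ A v w)
    (st' : ∀ u v w, le' u v → le' v w → A u w → A u v ∧ A v w)
    (eqb : ∀ u v, (le u v ∧ le v u) ↔ ∀ w, A u w ↔ A v w)
    {a b c : X} (hab : ¬ le b a) (hbc : ¬ le c b) (hac : A a c) :
    (le' a b ∧ le' b c) ∨ (le' c b ∧ le' b a) := by
  have lab : le a b := (total a b).resolve_right hab
  have lbc : le b c := (total b c).resolve_right hbc
  obtain ⟨nab, nbc⟩ := st a b c lab lbc hac
  have h1 : ∃ w, (A b w ∧ A c w ∧ ¬ A a w) ∨ (A a w ∧ ¬ A b w ∧ ¬ A c w) := by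
    have : ¬ ∀ w, A a w ↔ A b w := fun h => hab ((eqb a b).2 h).2
    push Not at this
    obtain ⟨w, hw⟩ := this
    refine ⟨w, ?_⟩
    have := total w a
    have := total w b
    have := total w c
    have := st w a b
    have := st a w b
    have := st b w c
    have := st a w c
    have := st b c w
    have := st w b c
    have := symm a w
    have := symm w a
    have := symm b w
    have := symm w b
    have := symm w c
    have := symm c w
    grind
  have h2 : ∃ w, (A c w ∧ ¬ A b w ∧ ¬ A a w) ∨ (A a w ∧ A b w ∧ ¬ A c w) := by
    have : ¬ ∀ w, A b w ↔ A c w := fun h => hbc ((eqb b c).2 h).2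
    push Not at this
    obtain ⟨w, hw⟩ := this
    refine ⟨w, ?_⟩
    have := total w a
    have := total w b
    have := total w c
    have := st w a b
    have := st a w b
    have := st b w c
    have := st a w c
    have := st b c w
    have := st w b c
    have := st a b w
    have := symm a w
    have := symm w a
    have := symm b w
    have := symm w b
    have := symm w c
    have := symm c w
    grind
  -- the middle vertex of an induced path lies between its ends
  have P3 : ∀ x y z, A x y → A y z → ¬ A x z → (le' x y ∧ le' y z) ∨ (le' z y ∧ le' y x) := by
    intro x y z p q r
    have := total' x y
    have := total' y z
    have := total' x z
    have := st' x z y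
    have := st' z x y
    have := st' y x z
    have := st' y z x
    have := symm z y
    have := symm y z
    have := symm x y
    have := symm x z
    have := symm z x
    grind
  obtain ⟨w, ⟨wb, wc, wa⟩ | ⟨wa, wb, wc⟩⟩ := h1 <;>
    obtain ⟨x, ⟨xc, xb, xa⟩ | ⟨xa, xb, xc⟩⟩ := h2
  · have := P3 a c x hac xc xa
    have := P3 b c x nbc xc xb
    have := P3 a b w nab wb wa
    have := st' w a c
    have := st' c a w
    have := trans' a b w
    have := trans' w b a
    have := total' a b
    have := total' b c
    have := symm w a
    have := symm w c
    grind
  · have := P3 a b w nab wb wa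
    have := P3 c b x (symm _ _ nbc) xb xc
    have := st' w a c
    have := st' c a w
    have := st' x c a
    have := st' a c x
    have := total' a b
    have := total' b c
    have := total' a c
    have := trans' a b w
    have := trans' w b a
    have := trans' c b w
    have := trans' w b c
    have := trans' c b x
    have := trans' x b c
    have := trans' a b x
    have := trans' x b a
    have := symm w a
    have := symm c w
    have := symm x c
    have := symm x a
    grind
  · have := P3 a c x hac xc xa
    have := P3 b c x nbc xc xb
    have := P3 b a w (symm _ _ nab) wa wb
    have := P3 c a w (symm _ _ hac) wa wc
    have := total' a b
    have := total' b c
    grind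
  · have := P3 b a w (symm _ _ nab) wa wb
    have := P3 c a w (symm _ _ hac) wa wc
    have := P3 c b x (symm _ _ nbc) xb xc
    have := st' x c a
    have := st' a c x
    have := trans' c b x
    have := trans' x b c
    have := total' a b
    have := total' b c
    have := symm x a
    have := symm x c
    grind

end Abstract

/-! ### Blocks, closed adjacency and components -/

namespace GraphOn

variable {G S : GraphOn V} {u v w : V}

theorem SameBlock.refl (h : u ∈ G.verts) : G.SameBlock u u := ⟨h, h, fun _ => Iff.rfl⟩

theorem SameBlock.symm (h : G.SameBlock u v) : G.SameBlock v u :=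
  ⟨h.2.1, h.1, fun w => (h.2.2 w).symm⟩

theorem SameBlock.trans (h : G.SameBlock u v) (h' : G.SameBlock v w) : G.SameBlock u w :=
  ⟨h.1, h'.2.1, fun x => (h.2.2 x).trans (h'.2.2 x)⟩

theorem SameBlock.adj_or_eq (h : G.SameBlock u v) : G.Adj u v ∨ u = v :=
  (h.2.2 v).2 (Or.inr rfl)

theorem cAdj_iff : G.CAdj u v ↔ u ∈ G.verts ∧ v ∈ G.verts ∧ (G.Adj u v ∨ u = v) := by
  constructor
  · rintro (h | h)
    · exact ⟨(G.mem_of_adj h).1, (G.mem_of_adj h).2, Or.inl h⟩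
    · exact ⟨h.1, h.2.1, h.adj_or_eq⟩
  · rintro ⟨hu, _, h | rfl⟩
    · exact Or.inl h
    · exact Or.inr (SameBlock.refl hu)

theorem CAdj.symm (h : G.CAdj u v) : G.CAdj v u :=
  h.imp G.symm SameBlock.symm

theorem sameBlock_iff_cAdj (hu : u ∈ G.verts) (hv : v ∈ G.verts) :
    G.SameBlock u v ↔ ∀ w, G.CAdj u w ↔ G.CAdj v w := by
  simp only [cAdj_iff, SameBlock, hu, hv, true_and]
  refine forall_congr' fun w => ?_
  constructor
  · intro h
    rw [h]
  · intro h
    by_cases hw : w ∈ G.verts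
    · simpa [hw] using h
    · have h1 : ∀ x ∈ G.verts, ¬ (G.Adj x w ∨ x = w) := by
        rintro x hx (h | rfl)
        · exact hw (G.mem_of_adj h).2
        · exact hw hx
      exact iff_of_false (h1 u hu) (h1 v hv)

theorem Reach.refl (h : u ∈ G.verts) : G.Reach u u := ⟨h, h, .refl⟩

theorem Reach.trans (h : G.Reach u v) (h' : G.Reach v w) : G.Reach u w :=
  ⟨h.1, h'.2.1, h.2.2.trans h'.2.2⟩

theorem Reach.symm (h : G.Reach u v) : G.Reach v u := by
  refine ⟨h.2.1, h.1, ?_⟩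
  have := h.2.2
  induction this with
  | refl => exact .refl
  | @tail b c hb hbc ih =>
    exact (Relation.ReflTransGen.single (G.symm hbc)).trans
      (ih ⟨h.1, (G.mem_of_adj hbc).1, hb⟩)

theorem CAdj.reach (h : G.CAdj u v) : G.Reach u v := by
  obtain ⟨hu, hv, h | rfl⟩ := cAdj_iff.1 h
  · exact ⟨hu, hv, .single h⟩
  · exact Reach.refl hu

theorem SameBlock.reach (h : G.SameBlock u v) : G.Reach u v := CAdj.reach (Or.inr h)

theorem CAdj.of_induced (hi : IsInduced S G) (h : S.CAdj u v) : G.CAdj u v := by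
  rw [cAdj_iff] at h ⊢
  exact ⟨hi.1 h.1, hi.1 h.2.1, h.2.2.imp_left (hi.2 u h.1 v h.2.1).1⟩

theorem SameBlock.of_induced (hi : IsInduced S G) (hu : u ∈ S.verts) (hv : v ∈ S.verts)
    (h : G.SameBlock u v) : S.SameBlock u v := by
  rw [sameBlock_iff_cAdj hu hv]
  have h' := (sameBlock_iff_cAdj h.1 h.2.1).1 h
  have key : ∀ x w, x ∈ S.verts → w ∈ S.verts → (S.CAdj x w ↔ G.CAdj x w) := by
    intro x w hx hw
    simp only [cAdj_iff, hx, hw, hi.1 hx, hi.1 hw, hi.2 x hx w hw]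
  intro w
  by_cases hw : w ∈ S.verts
  · rw [key u w hu hw, key v w hv hw, h']
  · simp [cAdj_iff, hw]

end GraphOn

namespace StraightEnum

variable {G S : GraphOn V}

/-- The reversed straight enumeration. -/
def reverse (σ : StraightEnum G) : StraightEnum G where
  le u v := σ.le v u
  refl := σ.refl
  trans u hu v hv w hw h h' := σ.trans w hw v hv u hu h' h
  total u hu v hv := σ.total v hv u hu
  eq_block u hu v hv := and_comm.trans (σ.eq_block u hu v hv)
  straight u hu v hv w hw h h' hc :=
    ((σ.straight w hw v hv u hu h' h hc.symm).symm.imp CAdj.symm CAdj.symm)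

variable (σ σ' : StraightEnum G)

/-- Components are consecutive in a straight enumeration. -/
theorem reach_convex {u v w : V} (h : G.Reach u w) (hv : v ∈ G.verts)
    (huv : σ.le u v) (hvw : σ.le v w) : G.Reach u v := by
  obtain ⟨hu, hw, hwalk⟩ := h
  have key : (σ.le u v ∧ σ.le v w) ∨ (σ.le w v ∧ σ.le v u) → G.Reach u v := by
    clear huv hvw
    induction hwalk with
    | refl =>
      rintro (⟨h1, h2⟩ | ⟨h2, h1⟩) <;> exact ((σ.eq_block u hu v hv).1 ⟨‹_›, ‹_›⟩).reach
    | @tail x w hux hxw ih =>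
      have hx := (G.mem_of_adj hxw).1
      have rx : G.Reach u x := ⟨hu, hx, hux⟩
      rintro (⟨h1, h2⟩ | ⟨h2, h1⟩)
      · rcases σ.total v hv x hx with h | h
        · exact ih hx (Or.inl ⟨h1, h⟩)
        · exact rx.trans (σ.straight x hx v hv w hw h h2 (Or.inl hxw)).1.reach
      · rcases σ.total v hv x hx with h | h
        · exact rx.trans (σ.straight w hw v hv x hx h2 h (Or.inl (G.symm hxw))).2.reach.symm
        · exact ih hx (Or.inr ⟨h, h1⟩)
  exact key (Or.inl ⟨huv, hvw⟩)

/-- The straight enumeration of a component is unique up to reversal. -/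
theorem eq_or_reverse_on_component (c : V) :
    (∀ u v, G.Reach c u → G.Reach c v → (σ'.le u v ↔ σ.le u v)) ∨
    (∀ u v, G.Reach c u → G.Reach c v → (σ'.le u v ↔ σ.le v u)) := by
  let X := {x // G.Reach c x}
  have mem : ∀ x : X, x.1 ∈ G.verts := fun x => x.2.2.1
  have tot : ∀ (τ : StraightEnum G) (u v : X), τ.le u v ∨ τ.le v u :=
    fun τ u v => τ.total u (mem u) v (mem v)
  have tra : ∀ (τ : StraightEnum G) (u v w : X), τ.le u v → τ.le v w → τ.le u w :=
    fun τ u v w => τ.trans u (mem u) v (mem v) w (mem w)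
  have str : ∀ (τ : StraightEnum G) (u v w : X), τ.le u v → τ.le v w → G.CAdj u w →
      G.CAdj u v ∧ G.CAdj v w :=
    fun τ u v w => τ.straight u (mem u) v (mem v) w (mem w)
  have eqb : ∀ (τ : StraightEnum G) (u v : X), (τ.le u v ∧ τ.le v u) ↔
      ∀ w : X, G.CAdj u w ↔ G.CAdj v w := by
    intro τ u v
    rw [τ.eq_block u (mem u) v (mem v), sameBlock_iff_cAdj (mem u) (mem v)]
    refine ⟨fun h w => h w, fun h w => ⟨fun hw => ?_, fun hw => ?_⟩⟩
    · exact (h ⟨w, u.2.trans hw.reach⟩).1 hw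
    · exact (h ⟨w, v.2.trans hw.reach⟩).2 hw
  have conn : ∀ u v : X, Relation.ReflTransGen (fun a b : X => G.CAdj a b) u v := by
    rintro ⟨u, hu⟩ ⟨v, hv⟩
    have hw : Relation.ReflTransGen G.Adj u v := (hu.symm.trans hv).2.2
    induction hw with
    | refl => exact .refl
    | @tail x y hux hxy ih =>
      have hx : G.Reach c x := hv.trans (CAdj.reach (Or.inl (G.symm hxy)))
      exact (ih hx).tail (Or.inl hxy)
  have main := eq_or_reverse_of_between (X := X) (le := fun a b => σ.le a b)
    (le' := fun a b => σ'.le a b) (A := fun a b => G.CAdj a b)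
    (tot σ) (tra σ) (tot σ') (tra σ') (fun u v => (eqb σ u v).trans (eqb σ' u v).symm)
    (fun _ _ h => h.symm) (str σ) (str σ') conn
    (fun a b d hab hbd had => between_of_adj (A := fun a b : X => G.CAdj a b)
      (le := fun a b : X => σ.le a b) (tot σ) (tot σ') (tra σ') (fun _ _ h => h.symm)
      (str σ) (str σ') (eqb σ) hab hbd had)
  exact main.imp (fun h u v hu hv => h ⟨u, hu⟩ ⟨v, hv⟩) (fun h u v hu hv => h ⟨u, hu⟩ ⟨v, hv⟩)

/-- A straight enumeration of `G` never interleaves the blocks of an induced subgraph. -/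
theorem le_of_sameBlock_of_le (hi : IsInduced S G) {u v w : V} (huv : S.SameBlock u v)
    (hw : w ∈ S.verts) (huw : ¬ S.SameBlock u w) (h : σ.le v w) : σ.le u w := by
  have hu := huv.1
  have hv := huv.2.1
  by_contra hn
  have hwu : σ.le w u := (σ.total u (hi.1 hu) w (hi.1 hw)).resolve_left hn
  have key : ∀ x y, x ∈ S.verts → y ∈ S.verts → (S.CAdj x y ↔ G.CAdj x y) := by
    intro x y hx hy
    simp only [cAdj_iff, hx, hy, hi.1 hx, hi.1 hy, hi.2 x hx y hy]
  apply huw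
  rw [sameBlock_iff_cAdj hu hw]
  intro x
  have hvx := (sameBlock_iff_cAdj hu hv).1 huv x
  by_cases hx : x ∈ S.verts
  · have huv' : G.CAdj u v := CAdj.of_induced hi (Or.inr huv)
    rw [key u x hu hx, key v x hv hx] at hvx
    rw [key u x hu hx, key w x hw hx]
    have := σ.total x (hi.1 hx) u (hi.1 hu)
    have := σ.total x (hi.1 hx) v (hi.1 hv)
    have := σ.total x (hi.1 hx) w (hi.1 hw)
    have := σ.straight v (hi.1 hv) w (hi.1 hw) u (hi.1 hu)
    have := σ.straight x (hi.1 hx) w (hi.1 hw) u (hi.1 hu)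
    have := σ.straight x (hi.1 hx) v (hi.1 hv) w (hi.1 hw)
    have := σ.straight v (hi.1 hv) x (hi.1 hx) u (hi.1 hu)
    have := σ.straight w (hi.1 hw) u (hi.1 hu) x (hi.1 hx)
    have := σ.straight v (hi.1 hv) w (hi.1 hw) x (hi.1 hx)
    have sy : ∀ a b, G.CAdj a b → G.CAdj b a := fun _ _ => CAdj.symm
    have := sy u x
    have := sy x u
    have := sy v x
    have := sy x v
    have := sy w x
    have := sy x w
    have := sy u v
    grind
  · simp [cAdj_iff, hx]

theorem le_of_le_of_sameBlock (hi : IsInduced S G) {u v w : V} (huv : S.SameBlock u v)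
    (hw : w ∈ S.verts) (huw : ¬ S.SameBlock u w) (h : σ.le w v) : σ.le w u :=
  σ.reverse.le_of_sameBlock_of_le hi huv hw huw h

end StraightEnum

/-! ### Simultaneous enumerations of sunflower graphs -/

section Sunflower

variable {k : ℕ} {G : Fin k → GraphOn V} {S : GraphOn V} {σ σ' : ∀ i, StraightEnum (G i)}

theorem StraightEnum.not_le_of_le {H : GraphOn V} (hi : IsInduced S H) (τ : StraightEnum H)
    {u v : V} (hu : u ∈ S.verts) (hv : v ∈ S.verts) (hb : ¬ S.SameBlock u v) (h : τ.le u v) :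
    ¬ τ.le v u := fun h' =>
  hb (SameBlock.of_induced hi hu hv ((τ.eq_block u (hi.1 hu) v (hi.1 hv)).1 ⟨h, h'⟩))

theorem IsSimEnum.le_iff (hsun : IsSunflower G S) (hσ : IsSimEnum G S σ) (i j : Fin k) {u v : V}
    (hu : u ∈ S.verts) (hv : v ∈ S.verts) (hb : ¬ S.SameBlock u v) :
    (σ i).le u v ↔ (σ j).le u v := by
  have key : ∀ i j, (σ i).le u v → (σ j).le u v := fun i j h =>
    hσ i j u hu v hv ⟨h, (σ i).not_le_of_le (hsun.1 i) hu hv hb h⟩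
  exact ⟨key i j, key j i⟩

theorem IsSimEnum.reverse (hσ : IsSimEnum G S σ) : IsSimEnum G S (fun i => (σ i).reverse) :=
  fun i j u hu v hv h => hσ i j v hv u hu h

/-- Every vertex reachable from a shared vertex `u` in the union graph lies in the component of a
shared vertex that is linked to `u` through components of the single graphs. -/
theorem exists_linked_shared (hsun : IsSunflower G S) {u v : V} (hu : u ∈ S.verts)
    {i₀ : Fin k} (hpath : Relation.ReflTransGen (unionGraph G).Adj u v) :
    ∃ s : {x // x ∈ S.verts}, ∃ i, (G i).Reach s v ∧
      Relation.ReflTransGen (fun a b : {x // x ∈ S.verts} => ∃ i, (G i).Reach a b) ⟨u, hu⟩ s := by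
  induction hpath with
  | refl => exact ⟨⟨u, hu⟩, i₀, Reach.refl ((hsun.1 i₀).1 hu), .refl⟩
  | @tail x y _ hxy ih =>
    obtain ⟨s, i, hs, hlink⟩ := ih
    obtain ⟨j, hj⟩ := hxy
    have hxy' : (G j).Reach x y := CAdj.reach (Or.inl hj)
    by_cases hij : i = j
    · subst hij
      exact ⟨s, i, hs.trans hxy', hlink⟩
    · have hx : x ∈ S.verts := by
        rw [← (hsun.2 i j hij).1]
        exact ⟨hs.2.1, hxy'.1⟩
      exact ⟨⟨x, hx⟩, j, hxy', hlink.tail ⟨i, hs⟩⟩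

/-- Two simultaneous enumerations of a connected sunflower graph order the blocks of the shared
graph identically, up to a full reversal. -/
theorem shared_eq_or_reverse (hsun : IsSunflower G S)
    (hconn : ∀ u ∈ (unionGraph G).verts, ∀ v ∈ (unionGraph G).verts,
      Relation.ReflTransGen (unionGraph G).Adj u v)
    (hσ : IsSimEnum G S σ) (hσ' : IsSimEnum G S σ') :
    (∀ i, ∀ u ∈ S.verts, ∀ v ∈ S.verts, ¬ S.SameBlock u v → ((σ' i).le u v ↔ (σ i).le u v)) ∨
    (∀ i, ∀ u ∈ S.verts, ∀ v ∈ S.verts, ¬ S.SameBlock u v →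
      ((σ' i).le u v ↔ (σ i).le v u)) := by
  rcases isEmpty_or_nonempty (Fin k) with hk | ⟨⟨i₀⟩⟩
  · exact Or.inl fun i => hk.elim i
  let X := {x // x ∈ S.verts}
  let L : (∀ i, StraightEnum (G i)) → X → X → Prop :=
    fun τ a b => S.SameBlock a b ∨ (τ i₀).le a b
  let A : X → X → Prop := fun a b => ∃ i, (G i).Reach a b
  have hi := hsun.1
  have mem : ∀ i, ∀ x : X, x.1 ∈ (G i).verts := fun i x => (hi i).1 x.2
  have tot : ∀ (τ : ∀ i, StraightEnum (G i)) u v, L τ u v ∨ L τ v u := fun τ u v =>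
    ((τ i₀).total u (mem _ u) v (mem _ v)).imp Or.inr Or.inr
  have tra : ∀ (τ : ∀ i, StraightEnum (G i)) u v w, L τ u v → L τ v w → L τ u w := by
    intro τ u v w huv hvw
    by_cases huw : S.SameBlock u w
    · exact Or.inl huw
    right
    rcases huv with h1 | h1 <;> rcases hvw with h2 | h2
    · exact absurd (h1.trans h2) huw
    · exact (τ i₀).le_of_sameBlock_of_le (hi i₀) h1 w.2 huw h2
    · exact (τ i₀).le_of_le_of_sameBlock (hi i₀) h2.symm u.2 (fun h => huw h.symm) h1
    · exact (τ i₀).trans u (mem _ u) v (mem _ v) w (mem _ w) h1 h2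
  have eqb : ∀ (τ : ∀ i, StraightEnum (G i)) u v, (L τ u v ∧ L τ v u) ↔ S.SameBlock u v := by
    intro τ u v
    constructor
    · rintro ⟨h1 | h1, h2 | h2⟩
      · exact h1
      · exact h1
      · exact h2.symm
      · exact SameBlock.of_induced (hi i₀) u.2 v.2
          (((τ i₀).eq_block u (mem _ u) v (mem _ v)).1 ⟨h1, h2⟩)
    · exact fun h => ⟨Or.inl h, Or.inl h.symm⟩
  have loc : ∀ (τ : ∀ i, StraightEnum (G i)), IsSimEnum G S τ → ∀ i (u v : X),
      ¬ S.SameBlock u v → (L τ u v ↔ (τ i).le u v) := by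
    intro τ hτ i u v huv
    simp only [L, huv, false_or]
    exact hτ.le_iff hsun i₀ i u.2 v.2 huv
  have sbr : ∀ i (u v : X), S.SameBlock u v → (G i).Reach u v := fun i u v h =>
    (CAdj.of_induced (hi i) (Or.inr h)).reach
  have conv : ∀ (τ : ∀ i, StraightEnum (G i)), IsSimEnum G S τ → ∀ i (u v w : X),
      L τ u v → L τ v w → (G i).Reach u w → (G i).Reach u v := by
    intro τ hτ i u v w huv hvw huw
    by_cases h1 : S.SameBlock u v
    · exact sbr i u v h1
    by_cases h2 : S.SameBlock v w
    · exact huw.trans (sbr i v w h2).symm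
    · exact (τ i).reach_convex huw (mem _ v) ((loc τ hτ i u v h1).1 huv) ((loc τ hτ i v w h2).1 hvw)
  have str : ∀ (τ : ∀ i, StraightEnum (G i)), IsSimEnum G S τ → ∀ u v w, L τ u v → L τ v w →
      A u w → A u v ∧ A v w := by
    rintro τ hτ u v w huv hvw ⟨i, huw⟩
    have := conv τ hτ i u v w huv hvw huw
    exact ⟨⟨i, this⟩, ⟨i, this.symm.trans huw⟩⟩
  have conn : ∀ u v, Relation.ReflTransGen A u v := by
    intro u v
    obtain ⟨s, i, hs, hl⟩ := exists_linked_shared hsun u.2 (i₀ := i₀)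
      (hconn u (Set.mem_iUnion.2 ⟨i₀, mem _ u⟩) v (Set.mem_iUnion.2 ⟨i₀, mem _ v⟩))
    exact hl.tail ⟨i, hs⟩
  have main := eq_or_reverse_of_between (le := L σ) (le' := L σ') (A := A) (tot σ) (tra σ)
    (tot σ') (tra σ') (fun u v => (eqb σ u v).trans (eqb σ' u v).symm)
    (fun _ _ ⟨i, h⟩ => ⟨i, h.symm⟩) (str σ hσ) (str σ' hσ') conn (by
      rintro a b c hab hbc ⟨i, hac⟩
      have lab : L σ a b := (tot σ a b).resolve_right hab
      have lbc : L σ b c := (tot σ b c).resolve_right hbc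
      have rb := conv σ hσ i a b c lab lbc hac
      have nab : ¬ S.SameBlock a b := fun h => hab (Or.inl h.symm)
      have nbc : ¬ S.SameBlock b c := fun h => hbc (Or.inl h.symm)
      have nba : ¬ S.SameBlock b a := fun h => nab h.symm
      have ncb : ¬ S.SameBlock c b := fun h => nbc h.symm
      have ra : (G i).Reach a a := Reach.refl (mem i a)
      rw [loc σ hσ i _ _ nab] at lab
      rw [loc σ hσ i _ _ nbc] at lbc
      rw [loc σ' hσ' i _ _ nab, loc σ' hσ' i _ _ nbc, loc σ' hσ' i _ _ nba,
        loc σ' hσ' i _ _ ncb]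
      rcases (σ i).eq_or_reverse_on_component (σ' i) a with h | h
      · exact Or.inl ⟨(h _ _ ra rb).2 lab, (h _ _ rb hac).2 lbc⟩
      · exact Or.inr ⟨(h _ _ hac rb).2 lbc, (h _ _ rb ra).2 lab⟩)
  refine main.imp (fun h i u hu v hv hb => ?_) (fun h i u hu v hv hb => ?_)
  · rw [← loc σ' hσ' i ⟨u, hu⟩ ⟨v, hv⟩ hb, ← loc σ hσ i ⟨u, hu⟩ ⟨v, hv⟩ hb]
    exact h _ _
  · rw [← loc σ' hσ' i ⟨u, hu⟩ ⟨v, hv⟩ hb,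
      ← loc σ hσ i ⟨v, hv⟩ ⟨u, hu⟩ (fun h' => hb (SameBlock.symm h'))]
    exact h _ _

/-- In a connected sunflower graph, a component containing no shared vertex is everything. -/
theorem reach_or_exists_shared (hsun : IsSunflower G S)
    (hconn : ∀ u ∈ (unionGraph G).verts, ∀ v ∈ (unionGraph G).verts,
      Relation.ReflTransGen (unionGraph G).Adj u v)
    (i : Fin k) {u v : V} (hu : u ∈ (G i).verts) (hv : v ∈ (G i).verts) :
    (G i).Reach u v ∨ ∃ s ∈ S.verts, (G i).Reach u s := by
  by_cases hs : ∃ s ∈ S.verts, (G i).Reach u s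
  · exact Or.inr hs
  left
  have hpath := hconn u (Set.mem_iUnion.2 ⟨i, hu⟩) v (Set.mem_iUnion.2 ⟨i, hv⟩)
  clear hv
  induction hpath with
  | refl => exact Reach.refl hu
  | @tail x y _ hxy ih =>
    obtain ⟨j, hj⟩ := hxy
    have hij : i = j := by
      by_contra hij
      refine hs ⟨x, ?_, ih⟩
      rw [← (hsun.2 i j hij).1]
      exact ⟨ih.2.1, ((G j).mem_of_adj hj).1⟩
    subst hij
    exact ih.trans (CAdj.reach (Or.inl hj))

/-- The order of two components is determined by a pair of representatives. -/
theorem StraightEnum.le_iff_of_reach {H : GraphOn V} (τ : StraightEnum H) {u v s t : V}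
    (hus : H.Reach u s) (hvt : H.Reach v t) (huv : ¬ H.Reach u v) : τ.le u v ↔ τ.le s t := by
  have key : ∀ u v s, H.Reach u s → v ∈ H.verts → ¬ H.Reach u v → τ.le u v → τ.le s v := by
    intro u v s hus hv huv h
    by_contra hn
    have h' := (τ.total s hus.2.1 v hv).resolve_left hn
    exact huv (τ.reach_convex hus hv h h')
  have key' : ∀ u v s, H.Reach u s → v ∈ H.verts → ¬ H.Reach u v → (τ.le u v ↔ τ.le s v) :=
    fun u v s hus hv huv => ⟨key u v s hus hv huv,
      key s v u hus.symm hv fun h => huv (hus.trans h)⟩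
  have hsv : ¬ H.Reach s v := fun h => huv (hus.trans h)
  have hts : ¬ H.Reach t s := fun h => hsv (hvt.trans h).symm
  have hvs : ¬ H.Reach v s := fun h => hsv h.symm
  rw [key' u v s hus hvt.1 huv]
  have r1 := key v s t hvt hus.2.1 hvs
  have r2 := key t s v hvt.symm hus.2.1 hts
  have e : ∀ a, ¬ H.Reach s a → a ∈ H.verts → (τ.le s a ↔ ¬ τ.le a s) := by
    intro a ha ham
    constructor
    · intro h h'
      exact ha ((τ.eq_block s hus.2.1 a ham).1 ⟨h, h'⟩).reach
    · exact (τ.total s hus.2.1 a ham).resolve_right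
  rw [e v hsv hvt.1, e t (fun h => hts h.symm) hvt.2.1]
  exact not_congr ⟨r1, r2⟩

/-- Simultaneous enumerations agreeing on the blocks of `S` differ by valid flips. -/
theorem exists_flip (hsun : IsSunflower G S)
    (hconn : ∀ u ∈ (unionGraph G).verts, ∀ v ∈ (unionGraph G).verts,
      Relation.ReflTransGen (unionGraph G).Adj u v)
    (hσ : IsSimEnum G S σ) (hσ' : IsSimEnum G S σ')
    (agree : ∀ i, ∀ u ∈ S.verts, ∀ v ∈ S.verts, ¬ S.SameBlock u v →
      ((σ' i).le u v ↔ (σ i).le u v)) :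
    ∃ flip : Fin k → V → Prop, ValidFlips G S flip ∧
      ∀ i, ObtainedByFlip (G i) (flip i) (σ i).le (σ' i).le := by
  let flip : Fin k → V → Prop := fun i c => ∃ u v, (G i).Reach c u ∧ (G i).Reach c v ∧
    ¬ (G i).SameBlock u v ∧ (σ i).le u v ∧ (σ' i).le v u
  have hi := hsun.1
  have flip_iff : ∀ i c d, (G i).Reach c d → (flip i c ↔ flip i d) := by
    intro i c d h
    constructor
    · rintro ⟨u, v, hu, hv, r⟩
      exact ⟨u, v, h.symm.trans hu, h.symm.trans hv, r⟩
    · rintro ⟨u, v, hu, hv, r⟩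
      exact ⟨u, v, h.trans hu, h.trans hv, r⟩
  have of_flip : ∀ i c, flip i c → ∀ u v, (G i).Reach c u → (G i).Reach c v →
      ((σ' i).le u v ↔ (σ i).le v u) := by
    rintro i c ⟨x, y, hx, hy, hb, h1, h2⟩
    rcases (σ i).eq_or_reverse_on_component (σ' i) c with h | h
    · exact absurd (((σ i).eq_block x hx.2.1 y hy.2.1).1 ⟨h1, (h y x hy hx).1 h2⟩) hb
    · exact h
  have of_not_flip : ∀ i c, ¬ flip i c → ∀ u v, (G i).Reach c u → (G i).Reach c v →
      ((σ' i).le u v ↔ (σ i).le u v) := by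
    intro i c hf
    have hle : ∀ u v, (G i).Reach c u → (G i).Reach c v → (σ i).le u v → (σ' i).le u v := by
      intro u v hu hv h
      by_cases hb : (G i).SameBlock u v
      · exact (((σ' i).eq_block u hu.2.1 v hv.2.1).2 hb).1
      · by_contra hn
        exact hf ⟨u, v, hu, hv, hb, h, ((σ' i).total u hu.2.1 v hv.2.1).resolve_left hn⟩
    intro u v hu hv
    refine ⟨fun h => ?_, hle u v hu hv⟩
    rcases (σ i).total u hu.2.1 v hv.2.1 with h1 | h1
    · exact h1
    · have hb := ((σ' i).eq_block u hu.2.1 v hv.2.1).1 ⟨h, hle v u hv hu h1⟩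
      exact (((σ i).eq_block u hu.2.1 v hv.2.1).2 hb).1
  have loose : ∀ i c, c ∈ (G i).verts → flip i c → LooseAt (G i) S c := by
    refine fun i c hc hf => ⟨hc, fun u v hu hv hus hvs => ?_⟩
    by_contra hb
    have h1 := of_flip i c hf u v hu hv
    rw [agree i u hus v hvs hb] at h1
    have h2 := (σ i).total u hu.2.1 v hv.2.1
    have h3 := (σ i).not_le_of_le (hi i) hus hvs hb
    tauto
  have flip_imp : ∀ b i j c c', OrientedAt (G i) S c b → OrientedAt (G j) S c' b →
      flip i c → flip j c' := by
    rintro b i j c c' ⟨_, hb, u, v, hu, hv, hbu, hbv, huv⟩ ⟨_, _, x, y, hx, hy, hbx, hby, hxy⟩ hf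
    by_contra hn
    have inC : ∀ {z}, S.SameBlock b z → (G i).Reach c z := fun {z} hz =>
      hu.trans (CAdj.of_induced (hi i) (Or.inr (hbu.symm.trans hz))).reach
    have inC' : ∀ {z}, S.SameBlock b z → (G j).Reach c' z := fun {z} hz =>
      hx.trans (CAdj.of_induced (hi j) (Or.inr (hbx.symm.trans hz))).reach
    have tie : ∀ p q, S.SameBlock b p → S.SameBlock b q → ¬ (G i).SameBlock p q →
        (G j).SameBlock p q := by
      intro p q hp hq hpq
      have f := of_flip i c hf
      have g := of_not_flip j c' hn
      have f1 := f p q (inC hp) (inC hq)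
      have f2 := f q p (inC hq) (inC hp)
      have g1 := g p q (inC' hp) (inC' hq)
      have g2 := g q p (inC' hq) (inC' hp)
      have e1 := (σ i).eq_block p (inC hp).2.1 q (inC hq).2.1
      have e2 := (σ j).eq_block p (inC' hp).2.1 q (inC' hq).2.1
      have t := (σ i).total p (inC hp).2.1 q (inC hq).2.1
      have s1 := hσ i j p hp.2.1 q hq.2.1
      have s2 := hσ i j q hq.2.1 p hp.2.1
      have s3 := hσ' i j p hp.2.1 q hq.2.1
      have s4 := hσ' i j q hq.2.1 p hp.2.1
      simp only [StraightEnum.lt] at s1 s2 s3 s4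
      grind
    have nxy : (G i).SameBlock x y := by
      by_contra h
      exact hxy (tie x y hbx hby h)
    have hz : ∃ z, S.SameBlock b z ∧ ¬ (G i).SameBlock z x := by
      by_cases h : (G i).SameBlock u x
      · exact ⟨v, hbv, fun h' => huv (h.trans h'.symm)⟩
      · exact ⟨u, hbu, h⟩
    obtain ⟨z, hbz, hzx⟩ := hz
    exact hxy ((tie z x hbz hbx hzx).symm.trans
      (tie z y hbz hby fun h => hzx (h.trans nxy.symm)))
  refine ⟨flip, ⟨fun i c hc => loose i c hc, fun b _ i j c c' hc hc' => ⟨⟨?_, ?_⟩, fun hf => ?_⟩⟩,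
    fun i => ⟨flip_iff i, fun u hu v hv => ⟨fun huv => ⟨fun hf => ?_, fun hf => ?_⟩, fun huv => ?_⟩⟩⟩
  · exact flip_imp b i j c c' hc hc'
  · exact flip_imp b j i c' c hc' hc
  · exact loose j c' hc'.1 (flip_imp b i j c c' hc hc' hf)
  · exact of_flip i u hf u v (Reach.refl hu) huv
  · exact of_not_flip i u hf u v (Reach.refl hu) huv
  · obtain ⟨s, hs, hus⟩ := (reach_or_exists_shared hsun hconn i hu hv).resolve_left huv
    obtain ⟨t, ht, hvt⟩ := (reach_or_exists_shared hsun hconn i hv hu).resolve_left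
      (fun h => huv h.symm)
    rw [(σ' i).le_iff_of_reach hus hvt huv, (σ i).le_iff_of_reach hus hvt huv]
    refine agree i s hs t ht fun hb => huv ?_
    exact (hus.trans (CAdj.of_induced (hi i) (Or.inr hb)).reach).trans hvt.symm

/-- Valid flips turn simultaneous enumerations into simultaneous enumerations. -/
theorem IsSimEnum.of_flip (hsun : IsSunflower G S) (hσ : IsSimEnum G S σ)
    {flip : Fin k → V → Prop} (hflip : ValidFlips G S flip)
    (hob : ∀ i, ObtainedByFlip (G i) (flip i) (σ i).le (σ' i).le) : IsSimEnum G S σ' := by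
  intro i j u hu v hv hlt
  have hi := hsun.1
  have huG : ∀ i, u ∈ (G i).verts := fun i => (hi i).1 hu
  have hvG : ∀ i, v ∈ (G i).verts := fun i => (hi i).1 hv
  by_cases hb : S.SameBlock u v
  · have hr : ∀ i, (G i).Reach u v := fun i => (CAdj.of_induced (hi i) (Or.inr hb)).reach
    by_cases hbj : (G j).SameBlock u v
    · exact (((σ' j).eq_block u (huG j) v (hvG j)).2 hbj).1
    have hbi : ¬ (G i).SameBlock u v := fun h =>
      hlt.2 (((σ' i).eq_block u (huG i) v (hvG i)).2 h).2
    have ori : ∀ i, ¬ (G i).SameBlock u v → OrientedAt (G i) S u u := fun i h =>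
      ⟨huG i, hu, u, v, Reach.refl (huG i), hr i, SameBlock.refl hu, hb, h⟩
    have hf := (hflip.2 u hu i j u u (ori i hbi) (ori j hbj)).1
    have oi := ((hob i).2 u (huG i) v (hvG i)).1 (hr i)
    have oi' := ((hob i).2 v (hvG i) u (huG i)).1 (hr i).symm
    have oj := ((hob j).2 u (huG j) v (hvG j)).1 (hr j)
    have fi := (hob i).1 u v (hr i)
    have s1 := hσ i j u hu v hv
    have s2 := hσ i j v hv u hu
    simp only [StraightEnum.lt] at s1 s2 hlt
    grind
  · have key : ∀ i, ((σ' i).le u v ↔ (σ i).le u v) := by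
      intro i
      by_cases hr : (G i).Reach u v
      · refine (((hob i).2 u (huG i) v (hvG i)).1 hr).2 fun hf => hb ?_
        exact (hflip.1 i u (huG i) hf).2 u v (Reach.refl (huG i)) hr hu hv
      · exact ((hob i).2 u (huG i) v (hvG i)).2 hr
    exact (key j).2 ((hσ.le_iff hsun i j hu hv hb).1 ((key i).1 hlt.1))

end Sunflower

/-- For a connected sunflower graph with simultaneous enumeration
`ρ = σ`, a tuple `ρ' = σ'` of straight enumerations is a simultaneous enumeration iff
it can be obtained from `ρ` or from its full reversal through reversals of independent
components and of reversible parts (encoded by a valid family of component flips). -/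
theorem simEnum_characterization {V : Type u} [Fintype V] {k : ℕ}
    (G : Fin k → GraphOn V) (S : GraphOn V) (hsun : IsSunflower G S)
    (hconn : ∀ u ∈ (unionGraph G).verts, ∀ v ∈ (unionGraph G).verts,
      Relation.ReflTransGen (unionGraph G).Adj u v)
    (σ : ∀ i, StraightEnum (G i)) (hσ : IsSimEnum G S σ)
    (σ' : ∀ i, StraightEnum (G i)) :
    IsSimEnum G S σ' ↔
      ∃ flip : Fin k → V → Prop, ValidFlips G S flip ∧
        ((∀ i, ObtainedByFlip (G i) (flip i) (σ i).le (σ' i).le) ∨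
         (∀ i, ObtainedByFlip (G i) (flip i) (fun a b => (σ i).le b a) (σ' i).le)) := by
  constructor
  · intro hσ'
    rcases shared_eq_or_reverse hsun hconn hσ hσ' with h | h
    · obtain ⟨flip, hf, ho⟩ := exists_flip hsun hconn hσ hσ' h
      exact ⟨flip, hf, Or.inl ho⟩
    · obtain ⟨flip, hf, ho⟩ := exists_flip hsun hconn hσ.reverse hσ' h
      exact ⟨flip, hf, Or.inr ho⟩
  · rintro ⟨flip, hf, ho | ho⟩
    · exact hσ.of_flip hsun hf ho
    · exact hσ.reverse.of_flip hsun hf ho
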